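/- If m ∈ G(I^k), s ∈ set(m), x_s·m/x_{min(m)} ≺ v^k, and t ∈ set(x_s·m/x_{min(m̃)}), then t ∈ set(m); that is, set(x_s·m/x_{min(m̃)}) ⊆ set(m), where m̃ is the part of m supported in x_{l+1},…,x_n. -/

import Mathlib

open MvPolynomial Finset

/-- A monomial in `n` variables, recorded by its exponent vector
(index `i : Fin n` corresponds to the variable `x_{i+1}` of the paper). -/
abbrev Mon (n : ℕ) := Fin n →₀ ℕ

/-- The exponent vector of the single variable `x_{j+1}` (`0`-indexed `j`). -/
noncomputable def sing (n j : ℕ) : Mon n :=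
  Finsupp.onFinset Finset.univ (fun i => if (i : ℕ) = j then 1 else 0)
    (fun a _ => Finset.mem_univ a)

/-- Total degree of a monomial. -/
def deg {n : ℕ} (m : Mon n) : ℕ := m.sum fun _ e => e

/-- `m₁ <_lex m₂` for the lexicographic order with `x_1 > x_2 > ⋯ > x_n`. -/
def lexLT {n : ℕ} (m₁ m₂ : Mon n) : Prop :=
  ∃ i : Fin n, (∀ j : Fin n, j < i → m₁ j = m₂ j) ∧ m₁ i < m₂ i

def lexLE {n : ℕ} (m₁ m₂ : Mon n) : Prop := m₁ = m₂ ∨ lexLT m₁ m₂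

/-- `m₁ <_revlex m₂` : the increasing reverse lexicographic order. -/
def revLT {n : ℕ} (m₁ m₂ : Mon n) : Prop :=
  ∃ s : Fin n, (∀ i : Fin n, s < i → m₁ i = m₂ i) ∧ m₂ s < m₁ s

def revLE {n : ℕ} (m₁ m₂ : Mon n) : Prop := m₁ = m₂ ∨ revLT m₁ m₂

/-- `min(m)`: the (0-indexed) smallest index in the support of `m`. -/
noncomputable def minIdx {n : ℕ} (m : Mon n) : ℕ := sInf {j : ℕ | ∃ h : j < n, m ⟨j, h⟩ ≠ 0}

/-- `m̄`: the part of `m` supported in the variables `x_1, …, x_l`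
(0-indexed: indices `< l`). -/
noncomputable def lowPart {n : ℕ} (l : ℕ) (m : Mon n) : Mon n :=
  m.filter fun i => (i : ℕ) < l

/-- `m̃`: the part of `m` supported in the variables `x_{l+1}, …, x_n`
(0-indexed: indices `≥ l`). -/
noncomputable def highPart {n : ℕ} (l : ℕ) (m : Mon n) : Mon n :=
  m.filter fun i => l ≤ (i : ℕ)

/-- The exponent vector of `u = x_1 · x_{l+1}^{a_{l+1}} ⋯ x_n^{a_n}`, where
`a j` (for `l ≤ j < n`, 0-indexed) is the exponent of `x_{j+1}`. -/
noncomputable def uVec (n l : ℕ) (a : ℕ → ℕ) : Mon n :=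
  sing n 0 + ∑ j ∈ Finset.Ico l n, a j • sing n j

/-- The exponent vector of `v = x_l · x_n^{d-1}`. -/
noncomputable def vVec (n l d : ℕ) : Mon n :=
  sing n (l - 1) + (d - 1) • sing n (n - 1)

/-- The lexsegment `L(u,v)`: monomials `w` of degree `d` with `u ≥_lex w ≥_lex v`. -/
def lexSeg (n l d : ℕ) (a : ℕ → ℕ) : Set (Mon n) :=
  { w | deg w = d ∧ lexLE (vVec n l d) w ∧ lexLE w (uVec n l a) }

/-- The lexsegment ideal `I = (L(u,v)) ⊆ K[x_1,…,x_n]`. -/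
noncomputable def lexIdeal (n l d : ℕ) (a : ℕ → ℕ) (K : Type*) [Field K] :
    Ideal (MvPolynomial (Fin n) K) :=
  Ideal.span ((fun w => monomial w (1 : K)) '' lexSeg n l d a)

/-- `G(J)`: the minimal monomial generators of a monomial ideal `J`, i.e.
monomials `m ∈ J` with `m / x_i ∉ J` for every `i ∈ supp m`. -/
def minGens {n : ℕ} (K : Type*) [Field K] (J : Ideal (MvPolynomial (Fin n) K)) :
    Set (Mon n) :=
  { m | monomial m (1 : K) ∈ J ∧
      ∀ i ∈ m.support, monomial (m - Finsupp.single i 1) (1 : K) ∉ J }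

/-- `J_{<revlex m}`: the ideal generated by all `z ∈ G(J)` with `z <_revlex m`. -/
noncomputable def idealBelow {n : ℕ} (K : Type*) [Field K]
    (J : Ideal (MvPolynomial (Fin n) K)) (m : Mon n) : Ideal (MvPolynomial (Fin n) K) :=
  Ideal.span ((fun z => monomial z (1 : K)) '' { z | z ∈ minGens K J ∧ revLT z m })

/-- `set(m) = {j : x_j · m ∈ J_{<revlex m}}` (0-indexed). -/
def setOfGen {n : ℕ} (K : Type*) [Field K] (J : Ideal (MvPolynomial (Fin n) K))
    (m : Mon n) : Set ℕ :=
  { j | j < n ∧ monomial (m + sing n j) (1 : K) ∈ idealBelow K J m }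

/-- The order `≺` on monomials: compare first the degree of the part supported in
`x_1,…,x_l`, then `<_lex`. -/
def precLT {n : ℕ} (l : ℕ) (m₁ m₂ : Mon n) : Prop :=
  deg (lowPart l m₁) < deg (lowPart l m₂) ∨
    (deg (lowPart l m₁) = deg (lowPart l m₂) ∧ lexLT m₁ m₂)

/-- `w = g(z)`: `w` is the `<_revlex`-smallest minimal monomial generator of `J`
dividing the monomial `z` (the value of the decomposition function). -/
def isDecompOf {n : ℕ} (K : Type*) [Field K] (J : Ideal (MvPolynomial (Fin n) K))
    (z w : Mon n) : Prop :=
  w ∈ minGens K J ∧ w ≤ z ∧ ∀ w' ∈ minGens K J, w' ≤ z → revLE w w'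

namespace S14

noncomputable def e {n : ℕ} (i : Fin n) : Mon n := Finsupp.single i 1

lemma sing_eq {n : ℕ} (i : Fin n) : sing n (i : ℕ) = e i := by
  ext j
  simp only [sing, e, Finsupp.onFinset_apply, Finsupp.single_apply, Fin.ext_iff]
  simp [eq_comm]

lemma e_apply {n : ℕ} (i j : Fin n) : e i j = if i = j then 1 else 0 := by
  simp [e, Finsupp.single_apply]

lemma deg_eq {n : ℕ} (m : Mon n) : deg m = ∑ i, m i := by
  unfold deg
  exact Finsupp.sum_fintype _ _ (fun _ => rfl)

lemma deg_add {n : ℕ} (a b : Mon n) : deg (a + b) = deg a + deg b := by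
  simp [deg_eq, Finset.sum_add_distrib]

lemma deg_e {n : ℕ} (i : Fin n) : deg (e i) = 1 := by
  simp [deg_eq, e_apply]

def ld {n : ℕ} (l : ℕ) (m : Mon n) : ℕ :=
  ∑ i : Fin n, if (i : ℕ) < l then m i else 0

lemma ld_eq {n : ℕ} (l : ℕ) (m : Mon n) : deg (lowPart l m) = ld l m := by
  simp [deg_eq, lowPart, ld, Finsupp.filter_apply]

lemma ld_add {n : ℕ} (l : ℕ) (a b : Mon n) : ld l (a + b) = ld l a + ld l b := by
  simp only [ld, ← Finset.sum_add_distrib]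
  apply Finset.sum_congr rfl
  intro i _
  split_ifs <;> simp

lemma ld_e {n : ℕ} (l : ℕ) (i : Fin n) : ld l (e i) = if (i : ℕ) < l then 1 else 0 := by
  unfold ld
  rw [Finset.sum_eq_single i]
  · simp [e_apply]
  · intro b _ hb
    simp [e_apply, hb.symm]
  · simp

lemma ld_pos {n : ℕ} {l : ℕ} {m : Mon n} (i : Fin n) (hi : (i : ℕ) < l) : m i ≤ ld l m := by
  have := Finset.single_le_sum (f := fun i : Fin n => if (i : ℕ) < l then m i else 0)
    (fun _ _ => Nat.zero_le _) (Finset.mem_univ i)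
  simpa [hi, ld] using this

lemma v_apply {n l d : ℕ} (i : Fin n) : vVec n l d i =
    (if (i : ℕ) = l - 1 then 1 else 0) + (d - 1) * (if (i : ℕ) = n - 1 then 1 else 0) := by
  simp [vVec, sing]

lemma deg_v {n l d : ℕ} (hd : 2 ≤ d) (hl2 : 2 ≤ l) (hln : l ≤ n - 1) : deg (vVec n l d) = d := by
  have h1 : vVec n l d = e ⟨l - 1, by omega⟩ + (d - 1) • e ⟨n - 1, by omega⟩ := by
    rw [← sing_eq, ← sing_eq]; rfl
  have h2 : ∀ (c : ℕ) (x : Mon n), deg (c • x) = c * deg x := by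
    intro c x; simp [deg_eq, Finset.mul_sum]
  rw [h1, deg_add, h2, deg_e, deg_e]; omega

/-- key lex lemma -/
lemma ld_lt {n l d k : ℕ} (hd : 2 ≤ d) (hl2 : 2 ≤ l) (hln : l ≤ n - 1) (w : Mon n)
    (hw : deg w = k * d) (h : lexLT w (k • vVec n l d)) : ld l w < k := by
  obtain ⟨i, h1, h2⟩ := h
  have h3 : vVec n l d i ≠ 0 := by
    intro h0; simp [h0] at h2
  by_cases hi : (i : ℕ) = l - 1
  · have : ld l w = w i := by
      unfold ld
      rw [Finset.sum_eq_single i]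
      · rw [if_pos (by omega)]
      · intro b _ hb
        split_ifs with hbl
        · have hbi : b < i := by
            rw [Fin.lt_def]
            have : (b : ℕ) ≠ i := fun h => hb (Fin.ext h)
            omega
          rw [h1 b hbi]
          simp only [Finsupp.smul_apply, v_apply]
          rw [if_neg (by rw [Fin.lt_def] at hbi; omega), if_neg (by omega)]; simp
        · rfl
      · simp
    rw [this]
    simp only [Finsupp.smul_apply, v_apply] at h2
    rw [if_pos hi, if_neg (by omega)] at h2
    simpa using h2
  · have hi' : (i : ℕ) = n - 1 := by
      by_contra hne
      apply h3
      rw [v_apply, if_neg hi, if_neg hne]; simp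
    exfalso
    have : deg w < deg (k • vVec n l d) := by
      rw [deg_eq, deg_eq]
      apply Finset.sum_lt_sum
      · intro j _
        by_cases hj : j = i
        · rw [hj]; exact h2.le
        · refine (h1 j ?_).le
          rw [Fin.lt_def]
          have : (j : ℕ) ≠ i := fun h => hj (Fin.ext h)
          omega
      · exact ⟨i, Finset.mem_univ _, h2⟩
    have h5 : deg (k • vVec n l d) = k * d := by
      have : deg (k • vVec n l d) = k * deg (vVec n l d) := by
        simp [deg_eq, Finset.mul_sum]
      rw [this, deg_v hd hl2 hln]
    omega

lemma lex_total {n : ℕ} (a b : Mon n) : lexLE a b ∨ lexLT b a := by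
  by_cases h : a = b
  · exact Or.inl (Or.inl h)
  · obtain ⟨i, hi⟩ : ∃ i, a i ≠ b i := by
      by_contra hc; push Not at hc; exact h (Finsupp.ext hc)
    have hne : (Finset.univ.filter fun i => a i ≠ b i).Nonempty := ⟨i, by simp [hi]⟩
    obtain ⟨j, hj, hmin⟩ := Finset.exists_min_image _ id hne
    simp only [Finset.mem_filter, Finset.mem_univ, true_and, id] at hj hmin
    have heq : ∀ b', b' < j → a b' = b b' := by
      intro b' hb'
      by_contra hc
      exact absurd (hmin b' hc) (not_le.mpr hb')
    rcases lt_or_gt_of_ne hj with h1 | h1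
    · exact Or.inl (Or.inr ⟨j, heq, h1⟩)
    · exact Or.inr ⟨j, fun b' hb' => (heq b' hb').symm, h1⟩

lemma v_le_iff {n l d : ℕ} (hd : 2 ≤ d) (hl2 : 2 ≤ l) (hln : l ≤ n - 1) (w : Mon n)
    (hw : deg w = d) : lexLE (vVec n l d) w ↔ 1 ≤ ld l w := by
  constructor
  · intro h
    have hll : l - 1 < n := by omega
    have hv1 : vVec n l d ⟨l - 1, hll⟩ = 1 := by
      rw [v_apply, if_pos rfl, if_neg (by simp; omega)]; rfl
    have hp : w ⟨l - 1, hll⟩ ≤ ld l w := ld_pos _ (by simp; omega)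
    rcases h with h | ⟨i, h1, h2⟩
    · rw [← h] at hp ⊢; omega
    · by_cases hi : (i : ℕ) < l
      · have := ld_pos (m := w) i hi; omega
      · have := h1 ⟨l - 1, hll⟩ (by rw [Fin.lt_def]; simp; omega)
        omega
  · intro h
    rcases lex_total (vVec n l d) w with h1 | h1
    · exact h1
    · have := ld_lt (k := 1) hd hl2 hln w (by simpa using hw) (by simpa using h1)
      omega

lemma seg_move {n l d : ℕ} {a : ℕ → ℕ} (hd : 2 ≤ d) (hl2 : 2 ≤ l) (hln : l ≤ n - 1)
    {w : Mon n} {i t : Fin n} (hit : i < t) (hc : (t : ℕ) < l ∨ l ≤ (i : ℕ))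
    (h : w + e i ∈ lexSeg n l d a) : w + e t ∈ lexSeg n l d a := by
  obtain ⟨h1, h2, h3⟩ := h
  have hdeg : deg (w + e t) = d := by rw [← h1, deg_add, deg_add, deg_e, deg_e]
  refine ⟨hdeg, ?_, ?_⟩
  · rw [v_le_iff hd hl2 hln _ hdeg]
    rw [v_le_iff hd hl2 hln _ h1] at h2
    rw [ld_add, ld_e] at h2 ⊢
    rw [Fin.lt_def] at hit
    split_ifs at * <;> omega
  · have hlt : lexLT (w + e t) (w + e i) := by
      refine ⟨i, ?_, ?_⟩
      · intro j hj
        simp [e_apply, hj.ne', (hj.trans hit).ne']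
      · simp [e_apply, hit.ne']
    rcases h3 with h3 | ⟨q, h4, h5⟩
    · rw [← h3]; exact Or.inr hlt
    · obtain ⟨r, h6, h7⟩ := hlt
      right
      rcases lt_trichotomy q r with hqr | hqr | hqr
      · exact ⟨q, fun j hj => (h6 j (hj.trans hqr)).trans (h4 j hj), by rw [h6 q hqr]; exact h5⟩
      · subst hqr
        exact ⟨q, fun j hj => (h6 j hj).trans (h4 j hj), h7.trans h5⟩
      · exact ⟨r, fun j hj => (h6 j hj).trans (h4 j (hj.trans hqr)), by rw [← h4 r hqr]; exact h7⟩

def P (n l d : ℕ) (a : ℕ → ℕ) : ℕ → Set (Mon n)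
  | 0 => {0}
  | k + 1 => {m | ∃ x ∈ P n l d a k, ∃ y ∈ lexSeg n l d a, x + y = m}

lemma pow_eq (n l d : ℕ) (a : ℕ → ℕ) (K : Type*) [Field K] (k : ℕ) :
    (lexIdeal n l d a K) ^ k = Ideal.span ((fun w => monomial w (1 : K)) '' P n l d a k) := by
  induction k with
  | zero => simp [P, Ideal.one_eq_top]
  | succ k ih =>
    rw [pow_succ, ih, lexIdeal, Ideal.span_mul_span']
    congr 1
    ext f
    simp only [Set.mem_mul, Set.mem_image, P, Set.mem_ofPred_eq]
    constructor
    · rintro ⟨_, ⟨x, hx, rfl⟩, _, ⟨y, hy, rfl⟩, rfl⟩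
      exact ⟨x + y, ⟨x, hx, y, hy, rfl⟩, by simp [monomial_mul]⟩
    · rintro ⟨_, ⟨x, hx, y, hy, rfl⟩, rfl⟩
      exact ⟨_, ⟨x, hx, rfl⟩, _, ⟨y, hy, rfl⟩, by simp [monomial_mul]⟩

lemma mem_span {n : ℕ} (K : Type*) [Field K] (S : Set (Mon n)) (m : Mon n) :
    monomial m (1 : K) ∈ Ideal.span ((fun w => monomial w (1 : K)) '' S) ↔ ∃ q ∈ S, q ≤ m := by
  classical
  rw [MvPolynomial.mem_ideal_span_monomial_image]
  simp [MvPolynomial.support_monomial]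

lemma P_deg {n l d : ℕ} {a : ℕ → ℕ} {k : ℕ} {m : Mon n} (h : m ∈ P n l d a k) :
    deg m = k * d := by
  induction k generalizing m with
  | zero => simp only [P, Set.mem_singleton_iff] at h; subst h; simp [deg_eq]
  | succ k ih =>
    obtain ⟨x, hx, y, hy, rfl⟩ := h
    rw [deg_add, ih hx, hy.1]; ring

lemma P_ld {n l d : ℕ} {a : ℕ → ℕ} (hd : 2 ≤ d) (hl2 : 2 ≤ l) (hln : l ≤ n - 1)
    {k : ℕ} {m : Mon n} (h : m ∈ P n l d a k) : k ≤ ld l m := by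
  induction k generalizing m with
  | zero => simp
  | succ k ih =>
    obtain ⟨x, hx, y, hy, rfl⟩ := h
    have h1 := ih hx
    have h2 := (v_le_iff hd hl2 hln y hy.1).1 hy.2.1
    rw [ld_add]; omega

lemma exists_sub {n : ℕ} {m : Mon n} {i : Fin n} (h : m i ≠ 0) : ∃ m', m = m' + e i := by
  refine ⟨m - e i, ?_⟩
  rw [tsub_add_cancel_of_le]
  exact Finsupp.single_le_iff.2 (by omega)

lemma P_move {n l d : ℕ} {a : ℕ → ℕ} (hd : 2 ≤ d) (hl2 : 2 ≤ l) (hln : l ≤ n - 1)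
    {k : ℕ} {w : Mon n} {i t : Fin n} (hit : i < t) (hc : (t : ℕ) < l ∨ l ≤ (i : ℕ))
    (h : w + e i ∈ P n l d a k) : w + e t ∈ P n l d a k := by
  induction k generalizing w with
  | zero =>
    have := P_deg h
    rw [deg_add, deg_e] at this; omega
  | succ k ih =>
    obtain ⟨x, hx, y, hy, hxy⟩ := h
    have h0 : x i + y i ≠ 0 := by
      have := DFunLike.congr_fun hxy i
      simp [e_apply] at this; omega
    by_cases hxi : x i = 0
    · obtain ⟨y', rfl⟩ := exists_sub (m := y) (i := i) (by omega)
      refine ⟨x, hx, y' + e t, seg_move hd hl2 hln hit hc hy, ?_⟩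
      rw [← add_assoc] at hxy ⊢
      rw [add_right_cancel hxy]
    · obtain ⟨x', rfl⟩ := exists_sub (m := x) (i := i) hxi
      refine ⟨x' + e t, ih hx, y, hy, ?_⟩
      have : w = x' + y := by
        apply add_right_cancel (b := e i)
        rw [← hxy]; abel
      rw [this]; abel

lemma deg_mono {n : ℕ} {a b : Mon n} (h : a ≤ b) : deg a ≤ deg b := by
  rw [deg_eq, deg_eq]; exact Finset.sum_le_sum fun i _ => h i

lemma gens_iff (n l d : ℕ) (a : ℕ → ℕ) (K : Type*) [Field K] (k : ℕ) (m : Mon n) :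
    m ∈ minGens K ((lexIdeal n l d a K) ^ k) ↔ m ∈ P n l d a k := by
  rw [pow_eq]
  simp only [minGens, Set.mem_ofPred_eq, mem_span]
  constructor
  · rintro ⟨⟨q, hq, hqm⟩, h⟩
    by_cases hqe : q = m
    · exact hqe ▸ hq
    · exfalso
      obtain ⟨i, hi⟩ : ∃ i, q i ≠ m i := by
        by_contra hc; push Not at hc; exact hqe (Finsupp.ext hc)
      have hlt : q i < m i := lt_of_le_of_ne (hqm i) hi
      refine h i (by simp; omega) ⟨q, hq, ?_⟩
      intro j
      have := hqm j
      simp only [Finsupp.tsub_apply, Finsupp.single_apply]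
      split_ifs with hij
      · subst hij; omega
      · omega
  · intro h
    refine ⟨⟨m, h, le_rfl⟩, ?_⟩
    rintro i hi ⟨q, hq, hqm⟩
    obtain ⟨m', rfl⟩ := exists_sub (Finsupp.mem_support_iff.1 hi)
    have h1 := P_deg h
    have h2 := P_deg hq
    have h3 := deg_mono hqm
    have : m' + e i - Finsupp.single i 1 = m' := by
      change m' + e i - e i = m'
      simp
    rw [this] at h3
    rw [deg_add, deg_e] at h1
    omega

lemma set_iff (n l d : ℕ) (a : ℕ → ℕ) (K : Type*) [Field K] (k : ℕ) (m : Mon n)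
    (hm : deg m = k * d) (j : Fin n) :
    (j : ℕ) ∈ setOfGen K ((lexIdeal n l d a K) ^ k) m ↔
      ∃ i, i < j ∧ ∃ z ∈ P n l d a k, z + e i = m + e j := by
  simp only [setOfGen, idealBelow, Set.mem_ofPred_eq, mem_span, gens_iff, sing_eq]
  constructor
  · rintro ⟨-, z, ⟨hz, s, hs1, hs2⟩, hle⟩
    obtain ⟨c, hc⟩ := exists_add_of_le hle
    have hdc : deg c = 1 := by
      have := congrArg deg hc
      rw [deg_add, deg_add, deg_e, P_deg hz, hm] at this
      omega
    have hc0 : ∃ i, c i ≠ 0 := by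
      by_contra hcc; push Not at hcc
      rw [deg_eq] at hdc; simp [hcc] at hdc
    obtain ⟨i, hi⟩ := hc0
    obtain ⟨c', rfl⟩ := exists_sub hi
    have hc' : c' = 0 := by
      rw [deg_add, deg_e, deg_eq] at hdc
      ext q
      have : ∑ i, c' i = 0 := by omega
      simpa using (Finset.sum_eq_zero_iff.1 this) q (Finset.mem_univ _)
    subst hc'
    rw [zero_add] at hc
    refine ⟨i, ?_, z, hz, hc.symm⟩
    have hpt : ∀ q, m q + (if j = q then 1 else 0) = z q + (if i = q then 1 else 0) := by
      intro q
      have := DFunLike.congr_fun hc q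
      simpa [e_apply] using this
    have h1 := hpt s
    have hjs : j = s := by
      by_contra hne
      rw [if_neg hne] at h1; omega
    subst hjs
    have hij : i ≠ j := by
      rintro rfl
      omega
    by_contra hcon
    have hlt : j < i := lt_of_le_of_ne (not_lt.1 hcon) hij.symm
    have h2 := hpt i
    rw [hs1 i hlt] at h2
    simp [hij.symm] at h2
  · rintro ⟨i, hij, z, hz, heq⟩
    refine ⟨j.2, z, ⟨hz, j, ?_, ?_⟩, ?_⟩
    · intro q hq
      have := DFunLike.congr_fun heq q
      simpa [e_apply, hq.ne, (hij.trans hq).ne] using this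
    · have := DFunLike.congr_fun heq j
      simp [e_apply, hij.ne] at this
      omega
    · rw [← heq]; exact le_self_add

lemma minIdx_spec {n : ℕ} (m : Mon n) (i : Fin n) (h : m i ≠ 0) :
    ∃ p : Fin n, (p : ℕ) = minIdx m ∧ m p ≠ 0 ∧ ∀ q, m q ≠ 0 → p ≤ q := by
  have hne : {j : ℕ | ∃ h : j < n, m ⟨j, h⟩ ≠ 0}.Nonempty := ⟨i, i.2, h⟩
  obtain ⟨h1, h2⟩ := Nat.sInf_mem hne
  refine ⟨⟨minIdx m, h1⟩, rfl, h2, ?_⟩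
  intro q hq
  exact Nat.sInf_le (s := {j : ℕ | ∃ h : j < n, m ⟨j, h⟩ ≠ 0}) ⟨q.2, hq⟩

lemma high_pos {n l : ℕ} (m : Mon n) {i : Fin n} (h : l ≤ (i : ℕ)) : highPart l m i = m i := by
  simp [highPart, Finsupp.filter_apply, h]

lemma high_neg {n l : ℕ} (m : Mon n) {i : Fin n} (h : ¬ l ≤ (i : ℕ)) : highPart l m i = 0 := by
  simp only [highPart, Finsupp.filter_apply, if_neg h]

end S14

open S14

/-- If `m ∈ G(I^k)`, `s ∈ set(m)` and `x_s·m/x_{min(m)} ≺ v^k`, then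
`set(x_s·m/x_{min(m̃)}) ⊆ set(m)`. -/
theorem stmt14 (n d l k : ℕ) (K : Type*) [Field K] (a : ℕ → ℕ)
    (hd : 2 ≤ d) (hl2 : 2 ≤ l) (hln : l ≤ n - 1)
    (hsum : ∑ j ∈ Finset.Ico l n, a j = d - 1) (hk : 1 ≤ k) :
    ∀ m ∈ minGens K ((lexIdeal n l d a K) ^ k),
      ∀ s ∈ setOfGen K ((lexIdeal n l d a K) ^ k) m,
        precLT l (m + sing n s - sing n (minIdx m)) (k • vVec n l d) →
          setOfGen K ((lexIdeal n l d a K) ^ k)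
              (m + sing n s - sing n (minIdx (highPart l m))) ⊆
            setOfGen K ((lexIdeal n l d a K) ^ k) m := by
  intro m hm s hs hprec t ht
  have hmP := (gens_iff n l d a K k m).1 hm
  have hmd := P_deg hmP
  have hml := P_ld hd hl2 hln hmP
  have hsn : s < n := hs.1
  obtain ⟨s, rfl⟩ : ∃ s' : Fin n, (s' : ℕ) = s := ⟨⟨s, hsn⟩, rfl⟩
  have htn : t < n := ht.1
  obtain ⟨t, rfl⟩ : ∃ t' : Fin n, (t' : ℕ) = t := ⟨⟨t, htn⟩, rfl⟩
  obtain ⟨i, his, z, hz, hzi⟩ := (set_iff n l d a K k m hmd s).1 hs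
  have hmi : m i ≠ 0 := by
    have := DFunLike.congr_fun hzi i
    simp [e_apply, his.ne'] at this
    omega
  -- consequences of the order hypothesis
  obtain ⟨μ, hμ, hμ0, -⟩ := minIdx_spec m i hmi
  obtain ⟨m0, hm0⟩ := exists_sub hμ0
  have hM : m + sing n s - sing n (minIdx m) = m0 + e s := by
    rw [← hμ, sing_eq, sing_eq, hm0, add_right_comm]; simp
  rw [hM] at hprec
  have hMd : deg (m0 + e s) = k * d := by
    rw [← hmd, hm0, deg_add, deg_add, deg_e, deg_e]
  have hldk : ld l (k • vVec n l d) = k := by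
    have h1 : ∀ x : Mon n, ld l (k • x) = k * ld l x := by
      intro x; simp [ld, Finset.mul_sum]
    have h2 : vVec n l d = e ⟨l - 1, by omega⟩ + (d - 1) • e ⟨n - 1, by omega⟩ := by
      rw [← sing_eq, ← sing_eq]; rfl
    have h3 : ∀ (c : ℕ) (x : Mon n), ld l (c • x) = c * ld l x := by
      intro c x; simp [ld, Finset.mul_sum]
    rw [h1, h2, ld_add, h3, ld_e, ld_e, if_pos (by simp; omega), if_neg (by simp; omega)]
    simp
  have hlt : ld l (m0 + e s) < k := by
    rcases hprec with h | ⟨-, h⟩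
    · rwa [ld_eq, ld_eq, hldk] at h
    · exact ld_lt hd hl2 hln _ hMd h
  have hmk : ld l m = k ∧ l ≤ (s : ℕ) := by
    rw [hm0, ld_add, ld_e] at hml ⊢
    rw [ld_add, ld_e] at hlt
    split_ifs at * <;> omega
  obtain ⟨hmk, hls⟩ := hmk
  have hli : l ≤ (i : ℕ) := by
    have h1 := P_ld hd hl2 hln hz
    have h2 := congrArg (ld l) hzi
    rw [ld_add, ld_add, ld_e, ld_e, hmk, if_neg (by omega : ¬ (s : ℕ) < l)] at h2
    split_ifs at h2 <;> omega
  -- the variable `p`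
  obtain ⟨p, hp, hp0, hpmin⟩ := minIdx_spec (highPart l m) i (by
    rw [high_pos _ hli]; exact hmi)
  have hlp : l ≤ (p : ℕ) := by
    by_contra hc
    exact hp0 (by rw [high_neg _ hc])
  rw [high_pos _ hlp] at hp0
  have hpmin' : ∀ q : Fin n, l ≤ (q : ℕ) → m q ≠ 0 → p ≤ q := by
    intro q hq hq0
    apply hpmin
    rw [high_pos _ hq]; exact hq0
  have hps : p < s := lt_of_le_of_lt (hpmin' i hli hmi) his
  obtain ⟨m1, hm1⟩ := exists_sub hp0
  have hM' : m + sing n s - sing n (minIdx (highPart l m)) = m1 + e s := by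
    rw [← hp, sing_eq, sing_eq, hm1, add_right_comm]; simp
  rw [hM'] at ht
  have hMd' : deg (m1 + e s) = k * d := by
    rw [← hmd, hm1, deg_add, deg_add, deg_e, deg_e]
  obtain ⟨j, hjt, y, hy, hyj⟩ := (set_iff n l d a K k _ hMd' t).1 ht
  rw [set_iff n l d a K k m hmd t]
  have hmj : m1 j + (if s = j then 1 else 0) ≠ 0 := by
    have := DFunLike.congr_fun hyj j
    simp [e_apply, hjt.ne'] at this
    omega
  have hm1le : ∀ q, m1 q ≤ m q := by
    intro q; rw [hm1]; simp
  by_cases htl : (t : ℕ) < l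
  · have hsj : s ≠ j := by
      rintro rfl
      rw [Fin.lt_def] at hjt; omega
    rw [if_neg hsj] at hmj
    have := hm1le j
    obtain ⟨m2, hm2⟩ := exists_sub (m := m) (i := j) (by omega)
    refine ⟨j, hjt, m2 + e t, P_move hd hl2 hln hjt (Or.inl htl) (hm2 ▸ hmP), ?_⟩
    rw [hm2]; abel
  · have hlj : l ≤ (j : ℕ) := by
      have h1 := P_ld hd hl2 hln hy
      have h2 := congrArg (ld l) hyj
      have h3 := hmk
      rw [hm1, ld_add, ld_e, if_neg (by omega)] at h3
      rw [ld_add, ld_add, ld_add, ld_e, ld_e, ld_e, if_neg (by omega : ¬ (s : ℕ) < l),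
        if_neg htl] at h2
      split_ifs at h2 <;> omega
    have hpt : p < t := by
      by_cases hsj : s = j
      · subst hsj; exact hps.trans hjt
      · rw [if_neg hsj] at hmj
        have := hm1le j
        exact lt_of_le_of_lt (hpmin' j hlj (by omega)) hjt
    refine ⟨p, hpt, m1 + e t, P_move hd hl2 hln hpt (Or.inr hlp) (hm1 ▸ hmP), ?_⟩
    rw [hm1]; abel
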